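/- Let R be a nonempty flexible graphon property. Then the maximum of W ↦ d₁(W,R) over W₀ is attained by a constant function: there exists p ∈ [0,1] such that d₁(W,R) ≤ d₁(p,R) for every W ∈ W₀, where p also denotes the function on [0,1]² that is identically equal to p. -/

import Mathlib

open MeasureTheory Filter Topology
open scoped ENNReal

noncomputable section

/-- The unit interval `[0,1]` as a subset of `ℝ`. -/
def I01 : Set ℝ := Set.Icc 0 1

/-- `W₀`: symmetric measurable functions `[0,1]² → [0,1]`
(represented as functions `ℝ → ℝ → ℝ`, with the relevant values on `[0,1]²`). -/
def IsGraphon (W : ℝ → ℝ → ℝ) : Prop :=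
  Measurable (Function.uncurry W) ∧ (∀ x y, W x y = W y x) ∧
    ∀ x y, W x y ∈ Set.Icc (0 : ℝ) 1

/-- The `L¹` norm of a kernel on `[0,1]²`. -/
def l1Norm (W : ℝ → ℝ → ℝ) : ℝ :=
  ∫ x in I01, ∫ y in I01, |W x y|

/-- The cut norm of a kernel on `[0,1]²`. -/
def cutNorm (W : ℝ → ℝ → ℝ) : ℝ :=
  sSup { r : ℝ | ∃ S T : Set ℝ, MeasurableSet S ∧ MeasurableSet T ∧ S ⊆ I01 ∧ T ⊆ I01 ∧
    r = |∫ x in S, ∫ y in T, W x y| }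

/-- An invertible measure preserving map of `[0,1]`. -/
structure InvMP where
  toFun : ℝ → ℝ
  invFun : ℝ → ℝ
  maps : ∀ x ∈ I01, toFun x ∈ I01
  mapsInv : ∀ x ∈ I01, invFun x ∈ I01
  measurePreserving :
    MeasurePreserving toFun (volume.restrict I01) (volume.restrict I01)
  measurePreservingInv :
    MeasurePreserving invFun (volume.restrict I01) (volume.restrict I01)
  leftInv : ∀ x ∈ I01, invFun (toFun x) = x
  rightInv : ∀ x ∈ I01, toFun (invFun x) = x

/-- `δ_□`: the cut distance, infimum of the cut norm over invertible measure
preserving transformations of `[0,1]`. -/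
def deltaCut (U W : ℝ → ℝ → ℝ) : ℝ :=
  ⨅ φ : InvMP, cutNorm (fun x y => U x y - W (φ.toFun x) (φ.toFun y))

/-- `δ₁`: the `L¹` distance minimized over invertible measure preserving
transformations of `[0,1]`. -/
def delta1 (U W : ℝ → ℝ → ℝ) : ℝ :=
  ⨅ φ : InvMP, l1Norm (fun x y => U x y - W (φ.toFun x) (φ.toFun y))



/-- A graph property: for each `n`, a set of simple graphs on `Fin n`. -/
def GraphProp := ∀ n : ℕ, Set (SimpleGraph (Fin n))

/-- Invariance under isomorphism (isomorphic graphs necessarily have the same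
number of vertices). -/
def IsGraphProperty (P : GraphProp) : Prop :=
  ∀ (n : ℕ) (G H : SimpleGraph (Fin n)), Nonempty (G ≃g H) → (G ∈ P n ↔ H ∈ P n)

/-- The normalized edit distance between graphs on a common vertex set. -/
def graphD1 {n : ℕ} (G H : SimpleGraph (Fin n)) : ℝ :=
  (symmDiff G.edgeSet H.edgeSet).ncard / (n ^ 2 : ℝ)

/-- The edit distance from a graph to a graph property (∞ if the property
contains no graph on the same number of nodes). -/
def graphD1P {n : ℕ} (G : SimpleGraph (Fin n)) (P : GraphProp) : ℝ≥0∞ :=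
  ⨅ (H : SimpleGraph (Fin n)) (_ : H ∈ P n), ENNReal.ofReal (graphD1 G H)

open Classical in
/-- The step function `W_G` associated with a graph `G` on `{1,…,n}`:
its value on `((i−1)/n, i/n] × ((j−1)/n, j/n]` is `1` iff `ij ∈ E(G)`. -/
def graphonOf {n : ℕ} (G : SimpleGraph (Fin n)) : ℝ → ℝ → ℝ := fun x y =>
  if ∃ i j : Fin n, G.Adj i j ∧ x ∈ Set.Ioc (((i : ℕ) : ℝ) / n) ((((i : ℕ) : ℝ) + 1) / n)
      ∧ y ∈ Set.Ioc (((j : ℕ) : ℝ) / n) ((((j : ℕ) : ℝ) + 1) / n)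
  then 1 else 0

/-- `H` is (isomorphic to) an induced subgraph of `G`. -/
def IsInducedSubgraph {n k : ℕ} (G : SimpleGraph (Fin n)) (H : SimpleGraph (Fin k)) : Prop :=
  ∃ f : Fin k ↪ Fin n, ∀ i j, H.Adj i j ↔ G.Adj (f i) (f j)

/-- The subgraph of `G` induced on the vertex subset `S` has property `P`
(as a graph on `k = |S|` nodes). -/
def inducedMem {n : ℕ} (G : SimpleGraph (Fin n)) (S : Finset (Fin n)) (k : ℕ)
    (P : GraphProp) : Prop :=
  ∃ H : SimpleGraph (Fin k), H ∈ P k ∧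
    ∃ f : Fin k ↪ Fin n, (∀ i, f i ∈ S) ∧ ∀ i j, H.Adj i j ↔ G.Adj (f i) (f j)

/-- The number of `k`-element vertex subsets of `G` inducing a subgraph with property `P`. -/
def goodCount {n : ℕ} (G : SimpleGraph (Fin n)) (k : ℕ) (P : GraphProp) : ℕ :=
  {S : Finset (Fin n) | S.card = k ∧ inducedMem G S k P}.ncard

/-- Testability of a graph property (Definition 1.1 of the paper). -/
def GraphTestable (P : GraphProp) : Prop :=
  ∃ P' : GraphProp, IsGraphProperty P' ∧
    (∀ (n : ℕ) (G : SimpleGraph (Fin n)), G ∈ P n → ∀ k, 1 ≤ k → k ≤ n →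
      2 * n.choose k ≤ 3 * goodCount G k P') ∧
    (∀ ε : ℝ, 0 < ε → ∃ kε : ℕ, 1 ≤ kε ∧
      ∀ (n : ℕ) (G : SimpleGraph (Fin n)) (k : ℕ), kε ≤ k → k ≤ n →
        ENNReal.ofReal ε ≤ graphD1P G P →
        3 * goodCount G k P' ≤ n.choose k)

def cube (k : ℕ) : Set (Fin k → ℝ) := Set.univ.pi fun _ => I01

open Classical in
/-- The homomorphism density `t(F,W)`. -/
def homDensity {k : ℕ} (F : SimpleGraph (Fin k)) (W : ℝ → ℝ → ℝ) : ℝ :=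
  ∫ x in cube k, ∏ i : Fin k, ∏ j : Fin k,
    if i < j ∧ F.Adj i j then W (x i) (x j) else 1

open Classical in
/-- The induced density `t_ind(F,W)`. -/
def indDensity {k : ℕ} (F : SimpleGraph (Fin k)) (W : ℝ → ℝ → ℝ) : ℝ :=
  ∫ x in cube k, ∏ i : Fin k, ∏ j : Fin k,
    if i < j then (if F.Adj i j then W (x i) (x j) else 1 - W (x i) (x j)) else 1

/-- Isomorphism of functions in `W₀`: equality of all homomorphism densities. -/
def GraphonIso (U W : ℝ → ℝ → ℝ) : Prop :=
  ∀ (k : ℕ) (F : SimpleGraph (Fin k)), homDensity F U = homDensity F W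

open Classical in
/-- `P(G(k,W) ∈ R')`, the probability that the `W`-random graph on `k` nodes
has property `R'`. -/
def probIn (k : ℕ) (W : ℝ → ℝ → ℝ) (R' : GraphProp) : ℝ :=
  ∑ F : SimpleGraph (Fin k), if F ∈ R' k then indDensity F W else 0

/-- The `L¹` distance from `W` to a set `R` of kernels, with value `∞` for `R = ∅`. -/
def d1SetE (W : ℝ → ℝ → ℝ) (R : Set (ℝ → ℝ → ℝ)) : ℝ≥0∞ :=
  ⨅ (U : ℝ → ℝ → ℝ) (_ : U ∈ R), ENNReal.ofReal (l1Norm fun x y => W x y - U x y)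

/-- The cut-norm distance from `W` to a set `R` of kernels, with value `∞` for `R = ∅`. -/
def dCutSetE (W : ℝ → ℝ → ℝ) (R : Set (ℝ → ℝ → ℝ)) : ℝ≥0∞ :=
  ⨅ (U : ℝ → ℝ → ℝ) (_ : U ∈ R), ENNReal.ofReal (cutNorm fun x y => W x y - U x y)

/-- The open ball `B₁(R,c)` (within `W₀`). -/
def ball1 (R : Set (ℝ → ℝ → ℝ)) (c : ℝ) : Set (ℝ → ℝ → ℝ) :=
  {W | IsGraphon W ∧ d1SetE W R < ENNReal.ofReal c}

/-- The open ball `B_□(R,c)` (within `W₀`). -/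
def ballCut (R : Set (ℝ → ℝ → ℝ)) (c : ℝ) : Set (ℝ → ℝ → ℝ) :=
  {W | IsGraphon W ∧ dCutSetE W R < ENNReal.ofReal c}

/-- A graphon property: a set of graphons invariant under isomorphism. -/
def IsGraphonProperty (R : Set (ℝ → ℝ → ℝ)) : Prop :=
  (∀ W ∈ R, IsGraphon W) ∧
    ∀ U W, IsGraphon U → IsGraphon W → GraphonIso U W → (U ∈ R ↔ W ∈ R)

/-- A set of graphons is closed if it is closed in the cut norm. -/
def CutClosed (R : Set (ℝ → ℝ → ℝ)) : Prop :=
  ∀ W, IsGraphon W →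
    (∀ ε : ℝ, 0 < ε → ∃ U ∈ R, cutNorm (fun x y => W x y - U x y) < ε) → W ∈ R

/-- Testability of a graphon property. -/
def GraphonTestable (R : Set (ℝ → ℝ → ℝ)) : Prop :=
  ∃ R' : GraphProp, IsGraphProperty R' ∧
    (∀ W ∈ R, ∀ k : ℕ, 1 ≤ k → (2 : ℝ) / 3 ≤ probIn k W R') ∧
    (∀ ε : ℝ, 0 < ε → ∃ kε : ℕ, 1 ≤ kε ∧ ∀ k, kε ≤ k → ∀ W, IsGraphon W →
      ENNReal.ofReal ε ≤ d1SetE W R → probIn k W R' ≤ 1 / 3)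

/-- The closure `P̄` of a graph property: limits of convergent sequences
of graphs in `P` with sizes tending to infinity. -/
def closureP (P : GraphProp) : Set (ℝ → ℝ → ℝ) :=
  {W | IsGraphon W ∧ ∃ (n : ℕ → ℕ) (G : ∀ m, SimpleGraph (Fin (n m))),
    (∀ m, G m ∈ P (n m)) ∧ Tendsto n atTop atTop ∧
    Tendsto (fun m => deltaCut (graphonOf (G m)) W) atTop (nhds 0)}

/-- A graph property is robust if graphs whose `W_G` is `d₁`-close to `P̄`
are themselves close to `P` in edit distance. -/
def Robust (P : GraphProp) : Prop :=
  ∀ ε : ℝ, 0 < ε → ∃ (N : ℕ) (ε' : ℝ), 1 ≤ N ∧ 0 < ε' ∧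
    ∀ (n : ℕ), N ≤ n → ∀ G : SimpleGraph (Fin n),
      d1SetE (graphonOf G) (closureP P) ≤ ENNReal.ofReal ε' →
      graphD1P G P ≤ ENNReal.ofReal ε

/-- A hereditary graph property: closed under induced subgraphs. -/
def Hereditary (P : GraphProp) : Prop :=
  ∀ (n : ℕ) (G : SimpleGraph (Fin n)), G ∈ P n →
    ∀ (k : ℕ) (H : SimpleGraph (Fin k)), IsInducedSubgraph G H → H ∈ P k

/-- `U` is a flexing of `W`: `U ∈ W₀` agrees with `W` wherever `W` takes value `0` or `1`. -/
def Flexing (U W : ℝ → ℝ → ℝ) : Prop :=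
  IsGraphon U ∧ ∀ x y, (W x y = 0 ∨ W x y = 1) → U x y = W x y

/-- A function property is flexible if it is preserved under flexing. -/
def FlexibleFamily (R : Set (ℝ → ℝ → ℝ)) : Prop :=
  ∀ W ∈ R, ∀ U, Flexing U W → U ∈ R

/-- `U' ≤ W'` almost everywhere on `[0,1]²`. -/
def aeLE (U W : ℝ → ℝ → ℝ) : Prop :=
  ∀ᵐ p ∂(volume.restrict (I01 ×ˢ I01)), U p.1 p.2 ≤ W p.1 p.2

/-- `U ⪯ W`: up to isomorphism, `U ≤ W` almost everywhere. -/
def graphonLE (U W : ℝ → ℝ → ℝ) : Prop :=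
  ∃ U' W', IsGraphon U' ∧ IsGraphon W' ∧ GraphonIso U U' ∧ GraphonIso W W' ∧ aeLE U' W'

/-- The upward closure of a graph property: graphs having a spanning subgraph in `P`. -/
def upP (P : GraphProp) : GraphProp :=
  fun n => {G | ∃ H : SimpleGraph (Fin n), H ∈ P n ∧ H ≤ G}

/-- The upward closure of a function property. -/
def upR (R : Set (ℝ → ℝ → ℝ)) : Set (ℝ → ℝ → ℝ) :=
  {W | IsGraphon W ∧ ∃ U ∈ R, graphonLE U W}

/-- A stepfunction: constant on the products of a finite measurable partition of `[0,1]`. -/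
def IsStepfunction (W : ℝ → ℝ → ℝ) : Prop :=
  ∃ (m : ℕ) (S : Fin m → Set ℝ), (∀ i, MeasurableSet (S i)) ∧
    (⋃ i, S i) = I01 ∧ (∀ i j, i ≠ j → Disjoint (S i) (S j)) ∧
    ∀ i j : Fin m, ∀ x ∈ S i, ∀ x' ∈ S i, ∀ y ∈ S j, ∀ y' ∈ S j, W x y = W x' y'

open Classical in
/-- A testable graphon functional: its value can be estimated from `W`-random graphs. -/
def TestableFunctional (f : (ℝ → ℝ → ℝ) → ℝ) : Prop :=
  ∃ g : ∀ n : ℕ, SimpleGraph (Fin n) → ℝ,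
    (∀ (n : ℕ) (G H : SimpleGraph (Fin n)), Nonempty (G ≃g H) → g n G = g n H) ∧
    ∀ ε : ℝ, 0 < ε → ∃ kε : ℕ, 1 ≤ kε ∧ ∀ k, kε ≤ k → ∀ W, IsGraphon W →
      (∑ F : SimpleGraph (Fin k), if ε < |f W - g k F| then indDensity F W else 0) < 1 / 3


def muI : Measure ℝ := volume.restrict I01

instance muI_prob : IsProbabilityMeasure muI := by
  constructor
  simp [muI, I01]

lemma muI_ae : ∀ᵐ x ∂muI, x ∈ Set.Ico (0:ℝ) 1 := by
  rw [muI, I01, ← restrict_Ico_eq_restrict_Icc]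
  exact ae_restrict_mem measurableSet_Ico

lemma muI_integral (F : ℝ → ℝ) : ∫ x, F x ∂muI = ∫ x in (0:ℝ)..1, F x := by
  rw [muI, I01, intervalIntegral.integral_of_le zero_le_one, integral_Icc_eq_integral_Ioc]

lemma split1 (N : ℕ) (hN : 0 < N) (F : ℝ → ℝ) (hF : Integrable F muI) :
    ∫ x, F x ∂muI = (1 / (N:ℝ)) * ∑ i ∈ Finset.range N, ∫ t, F (((i:ℝ) + t) / N) ∂muI := by
  have hN' : (0:ℝ) < N := by exact_mod_cast hN
  have h1 : ∀ i : ℕ, ∫ t, F (((i:ℝ) + t) / N) ∂muI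
      = N * ∫ x in ((i:ℝ)/N)..((i + 1 : ℕ):ℝ)/N, F x := by
    intro i
    rw [muI_integral]
    have := intervalIntegral.integral_comp_add_div (a := 0) (b := 1) F hN'.ne' ((i:ℝ)/N)
    simp only [smul_eq_mul] at this
    push_cast
    rw [show ((i:ℝ)+1)/N = (i:ℝ)/N + 1 / N by ring]
    rw [zero_div, add_zero] at this
    rw [← this]
    congr 1; ext t; congr 1; ring
  simp_rw [h1]
  rw [← Finset.mul_sum, muI_integral]
  have hI : IntervalIntegrable F volume 0 1 := by
    rw [intervalIntegrable_iff_integrableOn_Icc_of_le zero_le_one]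
    exact hF
  rw [intervalIntegral.sum_integral_adjacent_intervals (a := fun i : ℕ => (i:ℝ)/N)]
  · simp [hN'.ne']
  · intro k hk
    apply hI.mono_set
    have hk' : ((k:ℝ)+1) ≤ N := by exact_mod_cast hk
    rw [Set.uIcc_of_le zero_le_one, Set.uIcc_of_le (by push_cast; gcongr; linarith)]
    apply Set.Icc_subset_Icc
    · positivity
    · push_cast; rw [div_le_one hN']; exact hk'

lemma int_bdd {α : Type*} [MeasurableSpace α] (μ : Measure α) [IsFiniteMeasure μ] {f : α → ℝ}
    (hf : Measurable f) {C : ℝ} (h : ∀ x, |f x| ≤ C) : Integrable f μ :=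
  Integrable.of_bound hf.aestronglyMeasurable C (ae_of_all _ h)

lemma split2 (N : ℕ) (hN : 0 < N) (H : ℝ × ℝ → ℝ) (hH : Measurable H) (C : ℝ)
    (hC : ∀ p, |H p| ≤ C) :
    ∫ p, H p ∂(muI.prod muI) = ∫ p, (1 / (N:ℝ)) * ∑ i ∈ Finset.range N,
      ((1 / (N:ℝ)) * ∑ j ∈ Finset.range N, H (((i:ℝ) + p.1) / N, ((j:ℝ) + p.2) / N))
        ∂(muI.prod muI) := by
  have hb : ∀ {f : ℝ × ℝ → ℝ × ℝ}, Measurable f → Integrable (fun p => H (f p)) (muI.prod muI) :=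
    fun hf => int_bdd _ (hH.comp hf) (fun x => hC _)
  have hb0 : Integrable H (muI.prod muI) := hb measurable_id
  rw [integral_prod _ hb0]
  rw [split1 N hN _ hb0.integral_prod_left]
  rw [integral_const_mul, integral_finsetSum]
  swap
  · intro i _
    apply Integrable.const_mul
    apply integrable_finsetSum
    intro j _
    exact hb (by fun_prop)
  congr 1
  apply Finset.sum_congr rfl
  intro i _
  rw [integral_const_mul, integral_finsetSum]
  swap
  · intro j _
    exact hb (by fun_prop)
  have : ∀ t : ℝ, ∫ y, H (((i:ℝ) + t) / N, y) ∂muI = (1 / (N:ℝ)) * ∑ j ∈ Finset.range N,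
      ∫ s, H (((i:ℝ) + t) / N, ((j:ℝ) + s) / N) ∂muI := by
    intro t
    exact split1 N hN (fun y => H (((i:ℝ) + t) / N, y))
      (int_bdd _ (hH.comp (by fun_prop)) (fun x => hC _))
  simp_rw [this]
  rw [integral_const_mul, integral_finsetSum]
  · congr 1
    apply Finset.sum_congr rfl
    intro j _
    rw [integral_prod _ (hb (f := fun p => (((i:ℝ) + p.1) / N, ((j:ℝ) + p.2) / N)) (by fun_prop))]
  · intro j _
    exact (hb (f := fun p => (((i:ℝ) + p.1) / N, ((j:ℝ) + p.2) / N)) (by fun_prop)).integral_prod_left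

/-- The `N`-fold wrapping map. -/
def wrapMap (N : ℕ) (x : ℝ) : ℝ := Int.fract (N * x)

lemma wrapMap_meas (N : ℕ) : Measurable (wrapMap N) := by
  unfold wrapMap; fun_prop

lemma wrapMap_apply (N : ℕ) (hN : 0 < N) (i : ℕ) (t : ℝ) (ht : t ∈ Set.Ico (0:ℝ) 1) :
    wrapMap N (((i:ℝ) + t) / N) = t := by
  have hN' : (N:ℝ) ≠ 0 := by positivity
  rw [wrapMap, mul_div_cancel₀ _ hN', Int.fract_natCast_add]
  exact Int.fract_eq_self.2 ht

lemma wrapMap_mp (N : ℕ) (hN : 0 < N) : MeasurePreserving (wrapMap N) muI muI := by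
  have hN' : (N:ℝ) ≠ 0 := by positivity
  refine ⟨wrapMap_meas N, ?_⟩
  have : IsProbabilityMeasure (Measure.map (wrapMap N) muI) :=
    Measure.isProbabilityMeasure_map (wrapMap_meas N).aemeasurable
  ext s hs
  rw [← measureReal_eq_measureReal_iff]
  rw [map_measureReal_apply (wrapMap_meas N) hs]
  have hs' := wrapMap_meas N hs
  rw [← integral_indicator_one hs', ← integral_indicator_one hs]
  rw [split1 N hN]
  · have : ∀ i : ℕ, ∫ t, ((wrapMap N) ⁻¹' s).indicator 1 (((i:ℝ) + t) / N) ∂muI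
        = ∫ t, s.indicator (1 : ℝ → ℝ) t ∂muI := by
      intro i
      apply integral_congr_ae
      filter_upwards [muI_ae] with t ht
      have hiff : ((i:ℝ) + t) / N ∈ (wrapMap N) ⁻¹' s ↔ t ∈ s := by
        rw [Set.mem_preimage, wrapMap_apply N hN i t ht]
      by_cases hts : t ∈ s
      · rw [Set.indicator_of_mem hts, Set.indicator_of_mem (hiff.2 hts)]; rfl
      · rw [Set.indicator_of_notMem hts, Set.indicator_of_notMem (fun h => hts (hiff.1 h))]
    simp_rw [this]
    simp [hN']
  · exact (integrable_const (1:ℝ)).indicator hs'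

lemma mixing_cont (g : ℝ × ℝ → ℝ) (hg : UniformContinuous g) (C : ℝ) (hgC : ∀ p, |g p| ≤ C)
    (K : ℝ × ℝ → ℝ) (hK : Measurable K) (hK1 : ∀ p, |K p| ≤ 1) (ε : ℝ) (hε : 0 < ε) :
    ∃ N : ℕ, 0 < N ∧ |∫ p, K (wrapMap N p.1, wrapMap N p.2) * g p ∂(muI.prod muI)
      - (∫ p, K p ∂(muI.prod muI)) * ∫ p, g p ∂(muI.prod muI)| ≤ ε := by
  obtain ⟨δ, hδ, hgδ⟩ := Metric.uniformContinuous_iff.1 hg ε hε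
  obtain ⟨n, hn⟩ := exists_nat_one_div_lt hδ
  refine ⟨n+1, Nat.succ_pos n, ?_⟩
  set N := n + 1 with hNdef
  have hN : 0 < N := Nat.succ_pos n
  have hN' : (0:ℝ) < N := by exact_mod_cast hN
  have hNδ : 1 / (N:ℝ) < δ := by rw [hNdef]; push_cast; exact hn
  have hgm : Measurable g := hg.continuous.measurable
  have hC0 : 0 ≤ C := (abs_nonneg _).trans (hgC 0)
  set G : ℝ × ℝ → ℝ := fun p => (1 / (N:ℝ)) * ∑ i ∈ Finset.range N,
      ((1 / (N:ℝ)) * ∑ j ∈ Finset.range N, g (((i:ℝ) + p.1) / N, ((j:ℝ) + p.2) / N)) with hG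
  have hae : ∀ᵐ p ∂(muI.prod muI), p.1 ∈ Set.Ico (0:ℝ) 1 ∧ p.2 ∈ Set.Ico (0:ℝ) 1 := by
    have h1 := (Measure.quasiMeasurePreserving_fst (μ := muI) (ν := muI)).ae muI_ae
    have h2 := (Measure.quasiMeasurePreserving_snd (μ := muI) (ν := muI)).ae muI_ae
    filter_upwards [h1, h2] with p a b using ⟨a, b⟩
  have hGm : Measurable G := by
    apply Measurable.const_mul
    apply Finset.measurable_sum
    intro i _
    apply Measurable.const_mul
    apply Finset.measurable_sum
    intro j _
    exact hgm.comp (by fun_prop)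
  have avg : ∀ (f : ℕ → ℝ) (c : ℝ), (∀ i, |f i| ≤ c) →
      |(1 / (N:ℝ)) * ∑ i ∈ Finset.range N, f i| ≤ c := by
    intro f c hf
    rw [abs_mul, abs_of_pos (by positivity : 0 < 1 / (N:ℝ))]
    have : |∑ i ∈ Finset.range N, f i| ≤ N * c := by
      refine (Finset.abs_sum_le_sum_abs _ _).trans ?_
      refine (Finset.sum_le_sum fun i _ => hf i).trans ?_
      simp
    calc _ ≤ 1 / (N:ℝ) * (N * c) := by gcongr
      _ = c := by field_simp
  have hGC : ∀ p, |G p| ≤ C := fun p => avg _ _ fun i => avg _ _ fun j => hgC _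
  have hGosc : ∀ p q : ℝ × ℝ, p.1 ∈ Set.Ico (0:ℝ) 1 ∧ p.2 ∈ Set.Ico (0:ℝ) 1 →
      q.1 ∈ Set.Ico (0:ℝ) 1 ∧ q.2 ∈ Set.Ico (0:ℝ) 1 → |G p - G q| ≤ ε := by
    intro p q hp hq
    rw [hG]
    simp only
    rw [← mul_sub, ← Finset.sum_sub_distrib]
    apply avg
    intro i
    rw [← mul_sub, ← Finset.sum_sub_distrib]
    apply avg
    intro j
    have key : ∀ (i : ℕ) (a b : ℝ), a ∈ Set.Ico (0:ℝ) 1 → b ∈ Set.Ico (0:ℝ) 1 →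
        dist (((i:ℝ) + a) / N) (((i:ℝ) + b) / N) < δ := by
      intro i a b ha hb
      rw [Real.dist_eq, ← sub_div, abs_div, abs_of_pos hN']
      refine lt_of_le_of_lt ?_ hNδ
      gcongr
      rw [abs_le]
      constructor <;> linarith [ha.1, ha.2, hb.1, hb.2]
    have := hgδ (a := (((i:ℝ) + p.1) / N, ((j:ℝ) + p.2) / N))
      (b := (((i:ℝ) + q.1) / N, ((j:ℝ) + q.2) / N)) (by
        rw [Prod.dist_eq]
        exact max_lt (key _ _ _ hp.1 hq.1) (key _ _ _ hp.2 hq.2))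
    rw [Real.dist_eq] at this
    exact this.le
  have hgG : ∫ p, g p ∂(muI.prod muI) = ∫ p, G p ∂(muI.prod muI) := split2 N hN g hgm C hgC
  have hGi : Integrable G (muI.prod muI) := int_bdd _ hGm hGC
  have hGc : ∀ p : ℝ × ℝ, p.1 ∈ Set.Ico (0:ℝ) 1 ∧ p.2 ∈ Set.Ico (0:ℝ) 1 →
      |G p - ∫ p, g p ∂(muI.prod muI)| ≤ ε := by
    intro p hp
    have : G p - ∫ p, g p ∂(muI.prod muI) = ∫ q, (G p - G q) ∂(muI.prod muI) := by
      rw [integral_sub (integrable_const _) hGi, hgG]; simp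
    rw [this]
    have := norm_integral_le_of_norm_le_const (μ := muI.prod muI) (f := fun q => G p - G q) (C := ε)
      (by filter_upwards [hae] with q hq using hGosc p q hp hq)
    simpa using this
  have h1 : ∫ p, K (wrapMap N p.1, wrapMap N p.2) * g p ∂(muI.prod muI)
      = ∫ p, K p * G p ∂(muI.prod muI) := by
    rw [split2 N hN _ (C := C)]
    · apply integral_congr_ae
      filter_upwards [hae] with p hp
      simp only [wrapMap_apply N hN _ _ hp.1, wrapMap_apply N hN _ _ hp.2]
      rw [hG]
      simp only [← Finset.mul_sum]
      ring
    · have := wrapMap_meas N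
      exact (hK.comp (by fun_prop)).mul hgm
    · intro p
      rw [abs_mul]
      calc _ ≤ 1 * C := by gcongr; exacts [hK1 _, hgC _]
        _ = C := one_mul C
  rw [h1, ← integral_mul_const, ← integral_sub]
  · have := norm_integral_le_of_norm_le_const (μ := muI.prod muI)
      (f := fun a => K a * G a - K a * ∫ p, g p ∂(muI.prod muI)) (C := ε) (by
        filter_upwards [hae] with q hq
        rw [← mul_sub, norm_mul]
        calc _ ≤ 1 * ε := by gcongr; exacts [hK1 _, hGc q hq]
          _ = ε := one_mul _)
    simpa using this
  · refine int_bdd _ (C := C) (hK.mul hGm) ?_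
    intro p
    rw [abs_mul]
    calc _ ≤ 1 * C := by gcongr; exacts [hK1 _, hGC _]
        _ = C := one_mul C
  · exact (int_bdd _ hK hK1).mul_const _

lemma wrap2_mp (N : ℕ) (hN : 0 < N) :
    MeasurePreserving (fun p : ℝ × ℝ => (wrapMap N p.1, wrapMap N p.2))
      (muI.prod muI) (muI.prod muI) :=
  (wrapMap_mp N hN).prod (wrapMap_mp N hN)

lemma mixing (W : ℝ × ℝ → ℝ) (hW : Integrable W (muI.prod muI))
    (K : ℝ × ℝ → ℝ) (hK : Measurable K) (hK1 : ∀ p, |K p| ≤ 1) (ε : ℝ) (hε : 0 < ε) :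
    ∃ N : ℕ, 0 < N ∧ |∫ p, K (wrapMap N p.1, wrapMap N p.2) * W p ∂(muI.prod muI)
      - (∫ p, K p ∂(muI.prod muI)) * ∫ p, W p ∂(muI.prod muI)| ≤ ε := by
  obtain ⟨g, hgs, hgW, hgc, hgi⟩ := hW.exists_hasCompactSupport_integral_sub_le
    (show 0 < ε / 3 by positivity)
  obtain ⟨C, hC⟩ := hgs.exists_bound_of_continuous hgc
  obtain ⟨N, hN, h⟩ := mixing_cont g (hgs.uniformContinuous_of_continuous hgc) C hC K hK hK1
    (ε / 3) (by positivity)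
  refine ⟨N, hN, ?_⟩
  have hWg : Integrable (fun p => W p - g p) (muI.prod muI) := hW.sub hgi
  set ψ : ℝ × ℝ → ℝ := fun p => K (wrapMap N p.1, wrapMap N p.2) with hψ
  have hψm : Measurable ψ := hK.comp (wrap2_mp N hN).measurable
  have hψ1 : ∀ p, |ψ p| ≤ 1 := fun p => hK1 _
  have hmul : ∀ {f : ℝ × ℝ → ℝ}, Integrable f (muI.prod muI) →
      Integrable (fun p => ψ p * f p) (muI.prod muI) := fun hf =>
    hf.bdd_mul hψm.aestronglyMeasurable (ae_of_all _ hψ1)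
  have a1 : |∫ p, ψ p * W p ∂(muI.prod muI) - ∫ p, ψ p * g p ∂(muI.prod muI)| ≤ ε / 3 := by
    rw [← integral_sub (hmul hW) (hmul hgi)]
    refine (abs_integral_le_integral_abs).trans (le_trans ?_ hgW)
    apply integral_mono ((hmul hW).sub (hmul hgi)).abs hWg.norm
    intro p
    show |ψ p * W p - ψ p * g p| ≤ |W p - g p|
    rw [← mul_sub, abs_mul]
    exact mul_le_of_le_one_left (abs_nonneg _) (hψ1 p)
  have a2 : |∫ p, W p ∂(muI.prod muI) - ∫ p, g p ∂(muI.prod muI)| ≤ ε / 3 := by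
    rw [← integral_sub hW hgi]
    exact (abs_integral_le_integral_abs).trans hgW
  have a3 : |∫ p, K p ∂(muI.prod muI)| ≤ 1 := by
    have := norm_integral_le_of_norm_le_const (μ := muI.prod muI) (f := K) (ae_of_all _ hK1)
    simpa using this
  have a4 : |(∫ p, K p ∂(muI.prod muI)) * (∫ p, W p ∂(muI.prod muI) - ∫ p, g p ∂(muI.prod muI))|
      ≤ ε / 3 := by
    rw [abs_mul]
    exact (mul_le_of_le_one_left (abs_nonneg _) a3).trans a2
  rw [mul_sub] at a4
  rw [abs_le] at *
  constructor <;> linarith [a1.1, a1.2, a4.1, a4.2, h.1, h.2]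

lemma homDensity_wrap (N : ℕ) (hN : 0 < N) (U : ℝ → ℝ → ℝ) (hU : IsGraphon U) :
    GraphonIso (fun x y => U (wrapMap N x) (wrapMap N y)) U := by
  classical
  intro k F
  have hm : (volume : Measure (Fin k → ℝ)).restrict (cube k) = Measure.pi (fun _ => muI) := by
    rw [volume_pi, cube, Measure.restrict_pi_pi]
    rfl
  have hmp := measurePreserving_pi (ι := Fin k) (fun _ => muI) (fun _ => muI)
    (f := fun _ => wrapMap N) (fun _ => wrapMap_mp N hN)
  unfold homDensity
  rw [hm]
  conv_rhs => rw [← hmp.map_eq]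
  rw [integral_map hmp.measurable.aemeasurable]
  apply Measurable.aestronglyMeasurable
  apply Finset.measurable_prod
  intro i _
  apply Finset.measurable_prod
  intro j _
  split_ifs
  · exact hU.1.comp (f := fun x : Fin k → ℝ => (x i, x j)) (by fun_prop)
  · fun_prop

lemma l1Norm_eq (H : ℝ → ℝ → ℝ) (hH : Measurable (Function.uncurry H)) (C : ℝ)
    (hC : ∀ x y, |H x y| ≤ C) : l1Norm H = ∫ p, |H p.1 p.2| ∂(muI.prod muI) := by
  rw [integral_prod]
  · rfl
  · exact int_bdd _ (C := C) hH.abs (fun p => by rw [abs_abs]; exact hC _ _)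

lemma key_ineq (R : Set (ℝ → ℝ → ℝ)) (hR : IsGraphonProperty R) (hflex : FlexibleFamily R)
    (W : ℝ → ℝ → ℝ) (hW : IsGraphon W) (U : ℝ → ℝ → ℝ) (hUR : U ∈ R) (ε : ℝ) (hε : 0 < ε) :
    d1SetE W R ≤ ENNReal.ofReal
      (l1Norm (fun x y => (∫ p, W p.1 p.2 ∂(muI.prod muI)) - U x y) + ε) := by
  classical
  set w : ℝ := ∫ p, W p.1 p.2 ∂(muI.prod muI) with hw
  have hU := hR.1 U hUR
  have hWm : Measurable (fun p : ℝ × ℝ => W p.1 p.2) := hW.1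
  have hUm : Measurable (fun p : ℝ × ℝ => U p.1 p.2) := hU.1
  have hWi : Integrable (fun p : ℝ × ℝ => W p.1 p.2) (muI.prod muI) :=
    int_bdd _ (C := 1) hWm (fun p => by
      rw [abs_le]; constructor <;> linarith [(hW.2.2 p.1 p.2).1, (hW.2.2 p.1 p.2).2])
  have hw0 : 0 ≤ w := integral_nonneg (fun p => (hW.2.2 p.1 p.2).1)
  have hw1 : w ≤ 1 := by
    have := integral_mono hWi (integrable_const (1:ℝ)) (fun p => (hW.2.2 p.1 p.2).2)
    simpa using this
  set B : ℝ × ℝ → ℝ := fun p => if U p.1 p.2 = 1 then 1 else 0 with hB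
  set K : ℝ × ℝ → ℝ := fun p => if U p.1 p.2 = 0 then 1 else if U p.1 p.2 = 1 then -1 else 0 with hK
  have s0 : MeasurableSet {p : ℝ × ℝ | U p.1 p.2 = 0} := hUm (measurableSet_singleton 0)
  have s1 : MeasurableSet {p : ℝ × ℝ | U p.1 p.2 = 1} := hUm (measurableSet_singleton 1)
  have hBm : Measurable B := Measurable.ite s1 measurable_const measurable_const
  have hKm : Measurable K :=
    Measurable.ite s0 measurable_const (Measurable.ite s1 measurable_const measurable_const)
  have hB1 : ∀ p, |B p| ≤ 1 := by intro p; simp only [hB]; split_ifs <;> simp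
  have hK1 : ∀ p, |K p| ≤ 1 := by intro p; simp only [hK]; split_ifs <;> simp
  have hBi : Integrable B (muI.prod muI) := int_bdd _ hBm hB1
  have hKi : Integrable K (muI.prod muI) := int_bdd _ hKm hK1
  obtain ⟨N, hN, hmix⟩ := mixing _ hWi K hKm hK1 ε hε
  set V : ℝ → ℝ → ℝ := fun x y => U (wrapMap N x) (wrapMap N y) with hV
  have hwr := wrap2_mp N hN
  have hVm : Measurable (fun p : ℝ × ℝ => V p.1 p.2) := hUm.comp hwr.measurable
  have hVg : IsGraphon V := ⟨hVm, fun x y => hU.2.1 _ _, fun x y => hU.2.2 _ _⟩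
  have hVR : V ∈ R := (hR.2 V U hVg hU (homDensity_wrap N hN U hU)).2 hUR
  set V' : ℝ → ℝ → ℝ := fun x y => if V x y = 0 ∨ V x y = 1 then V x y else W x y with hV'
  have hV'm : Measurable (fun p : ℝ × ℝ => V' p.1 p.2) :=
    Measurable.ite ((hVm (measurableSet_singleton 0)).union (hVm (measurableSet_singleton 1)))
      hVm hWm
  have hV'g : IsGraphon V' := by
    refine ⟨hV'm, fun x y => ?_, fun x y => ?_⟩
    · simp only [hV', hVg.2.1 x y, hW.2.1 x y]
    · simp only [hV']
      split_ifs
      · exact hVg.2.2 _ _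
      · exact hW.2.2 _ _
  have hV'R : V' ∈ R := hflex V hVR V' ⟨hV'g, fun x y h => by simp only [hV', if_pos h]⟩
  refine (iInf₂_le V' hV'R).trans ?_
  apply ENNReal.ofReal_le_ofReal
  rw [l1Norm_eq (fun x y => W x y - V' x y) (hWm.sub hV'm) 1,
    l1Norm_eq (fun x y => w - U x y) (measurable_const.sub hUm) 1]
  rotate_left
  · intro x y
    rw [abs_le]; constructor <;> linarith [(hU.2.2 x y).1, (hU.2.2 x y).2]
  · intro x y
    rw [abs_le]; constructor <;>
      linarith [(hW.2.2 x y).1, (hW.2.2 x y).2, (hV'g.2.2 x y).1, (hV'g.2.2 x y).2]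
  have e1 : ∀ p : ℝ × ℝ, |W p.1 p.2 - V' p.1 p.2| = B (wrapMap N p.1, wrapMap N p.2)
      + K (wrapMap N p.1, wrapMap N p.2) * W p.1 p.2 := by
    intro p
    have h0 := (hW.2.2 p.1 p.2).1
    have h1 := (hW.2.2 p.1 p.2).2
    simp only [hV', hB, hK, hV]
    by_cases c0 : U (wrapMap N p.1) (wrapMap N p.2) = 0
    · simp [c0, abs_of_nonneg h0]
    · by_cases c1 : U (wrapMap N p.1) (wrapMap N p.2) = 1
      · simp only [c1]
        norm_num
        rw [abs_of_nonpos (by linarith)]; ring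
      · simp [c0, c1]
  have e2 : ∀ p : ℝ × ℝ, B p + K p * w ≤ |w - U p.1 p.2| := by
    intro p
    simp only [hB, hK]
    by_cases c0 : U p.1 p.2 = 0
    · simp [c0, abs_of_nonneg hw0]
    · by_cases c1 : U p.1 p.2 = 1
      · simp only [c1]
        norm_num
        rw [abs_of_nonpos (by linarith)]; linarith
      · simp [c0, c1]
  have hBw : ∫ p, B (wrapMap N p.1, wrapMap N p.2) ∂(muI.prod muI) = ∫ p, B p ∂(muI.prod muI) := by
    conv_rhs => rw [← hwr.map_eq]
    rw [integral_map hwr.measurable.aemeasurable hBm.aestronglyMeasurable]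
  have i1 : Integrable (fun p : ℝ × ℝ => B (wrapMap N p.1, wrapMap N p.2)) (muI.prod muI) :=
    int_bdd _ (hBm.comp hwr.measurable) (fun p => hB1 _)
  have i2 : Integrable (fun p : ℝ × ℝ => K (wrapMap N p.1, wrapMap N p.2) * W p.1 p.2)
      (muI.prod muI) :=
    hWi.bdd_mul (c := 1) (hKm.comp hwr.measurable).aestronglyMeasurable
      (ae_of_all _ fun p => hK1 _)
  simp_rw [e1]
  rw [integral_add i1 i2, hBw]
  have e3 : ∫ p, B p ∂(muI.prod muI) + (∫ p, K p ∂(muI.prod muI)) * w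
      ≤ ∫ p, |w - U p.1 p.2| ∂(muI.prod muI) := by
    rw [← integral_mul_const, ← integral_add hBi (hKi.mul_const _)]
    apply integral_mono (hBi.add (hKi.mul_const _)) _ e2
    apply int_bdd _ (C := 1) (measurable_const.sub hUm).abs
    intro p
    rw [abs_abs]
    show |w - U p.1 p.2| ≤ 1
    rw [abs_le]
    constructor <;> linarith [(hU.2.2 p.1 p.2).1, (hU.2.2 p.1 p.2).2]
  have := (abs_le.1 hmix).2
  linarith

lemma usc (R : Set (ℝ → ℝ → ℝ)) (hR : IsGraphonProperty R) :
    UpperSemicontinuous (fun p : ℝ => d1SetE (fun _ _ => p) R) := by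
  unfold d1SetE
  apply upperSemicontinuous_biInf
  intro U hU
  have hU := hR.1 U hU
  have hUm : Measurable (fun p : ℝ × ℝ => U p.1 p.2) := hU.1
  have hb : ∀ (p x y : ℝ), |p - U x y| ≤ |p| + 1 := by
    intro p x y
    refine (abs_sub _ _).trans ?_
    gcongr
    rw [abs_le]; constructor <;> linarith [(hU.2.2 x y).1, (hU.2.2 x y).2]
  apply Continuous.upperSemicontinuous
  apply ENNReal.continuous_ofReal.comp
  have : (fun p : ℝ => l1Norm fun x y => p - U x y)
      = fun p => ∫ q, |p - U q.1 q.2| ∂(muI.prod muI) := by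
    ext p
    exact l1Norm_eq _ (measurable_const.sub hUm) (|p| + 1) (hb p)
  rw [this]
  have hi : ∀ p : ℝ, Integrable (fun q : ℝ × ℝ => |p - U q.1 q.2|) (muI.prod muI) := fun p =>
    int_bdd _ (C := |p| + 1) (measurable_const.sub hUm).abs
      (fun q => by rw [abs_abs]; exact hb _ _ _)
  apply LipschitzWith.continuous (K := 1)
  apply LipschitzWith.of_dist_le_mul
  intro a b
  rw [Real.dist_eq, Real.dist_eq, ← integral_sub (hi a) (hi b)]
  have := norm_integral_le_of_norm_le_const (μ := muI.prod muI)
    (f := fun q : ℝ × ℝ => |a - U q.1 q.2| - |b - U q.1 q.2|) (C := |a - b|)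
    (ae_of_all _ fun q => by
      rw [Real.norm_eq_abs]
      refine (abs_abs_sub_abs_le_abs_sub _ _).trans ?_
      simp)
  simpa using this

theorem flexible_max_dist_attained_by_constant
    (R : Set (ℝ → ℝ → ℝ)) (hR : IsGraphonProperty R) (hne : R.Nonempty)
    (hflex : FlexibleFamily R) :
    ∃ p ∈ Set.Icc (0 : ℝ) 1, ∀ W : ℝ → ℝ → ℝ, IsGraphon W →
      d1SetE W R ≤ d1SetE (fun _ _ => p) R := by
  obtain ⟨p, hp, hmax⟩ := UpperSemicontinuousOn.exists_isMaxOn (s := Set.Icc (0:ℝ) 1)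
    ⟨0, by simp⟩ isCompact_Icc ((usc R hR).upperSemicontinuousOn _)
  refine ⟨p, hp, fun W hW => ?_⟩
  have hWm : Measurable (fun p : ℝ × ℝ => W p.1 p.2) := hW.1
  have hWi : Integrable (fun p : ℝ × ℝ => W p.1 p.2) (muI.prod muI) :=
    int_bdd _ (C := 1) hWm (fun p => by
      rw [abs_le]; constructor <;> linarith [(hW.2.2 p.1 p.2).1, (hW.2.2 p.1 p.2).2])
  have hw0 : 0 ≤ ∫ p, W p.1 p.2 ∂(muI.prod muI) :=
    integral_nonneg (fun p => (hW.2.2 p.1 p.2).1)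
  have hw1 : ∫ p, W p.1 p.2 ∂(muI.prod muI) ≤ 1 := by
    have := integral_mono hWi (integrable_const (1:ℝ)) (fun p => (hW.2.2 p.1 p.2).2)
    simpa using this
  refine le_trans ?_ (hmax ⟨hw0, hw1⟩)
  apply le_iInf₂
  intro U hU
  refine ENNReal.le_of_forall_pos_le_add fun ε hε _ => ?_
  refine (key_ineq R hR hflex W hW U hU ε hε).trans ?_
  refine ENNReal.ofReal_add_le.trans ?_
  simp

end
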